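/- arXiv:1709.03411 — 3 statements merged into one kernel-verified Lean document; each statement's English description precedes it below -/
import Mathlib

section
/- For every dimension d ≥ 1 there exist 2^{d-1}+1 points in d-dimensional Euclidean space ℝ^d such that any three of them form an acute triangle; that is, there is an acute set in ℝ^d of cardinality 2^{d-1}+1. -/
open Filter Topology

/-- Bit value. -/
noncomputable def acBit (b : Bool) : ℝ := if b then 1 else 0

/-- Cube coordinates of the perturbed points; `none` is the apex. -/
noncomputable def acQ {n : ℕ} (c : ℝ) (k : (Fin n → Bool) → ℝ) (t : ℝ) :
    Option (Fin n → Bool) → Fin n → ℝ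
  | none, _ => 1 / 2
  | some x, i => acBit (x i) + (1 - 2 * acBit (x i)) * (c * t ^ 2 * k x ^ 2)

/-- Height coordinate. -/
noncomputable def acG {n : ℕ} (k : (Fin n → Bool) → ℝ) (t : ℝ) :
    Option (Fin n → Bool) → ℝ
  | none => n + 1
  | some x => t * k x

/-- The inner product at the vertex `o₂`. -/
noncomputable def acF {n : ℕ} (c : ℝ) (k : (Fin n → Bool) → ℝ) (o₁ o₂ o₃ : Option (Fin n → Bool))
    (t : ℝ) : ℝ :=
  (acG k t o₁ - acG k t o₂) * (acG k t o₃ - acG k t o₂) +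
    ∑ i, (acQ c k t o₁ i - acQ c k t o₂ i) * (acQ c k t o₃ i - acQ c k t o₂ i)

theorem acQ_cont {n : ℕ} (c : ℝ) (k : (Fin n → Bool) → ℝ) (o : Option (Fin n → Bool)) (i : Fin n) :
    Continuous (fun t => acQ c k t o i) := by
  cases o <;> simp only [acQ] <;> fun_prop

theorem acG_cont {n : ℕ} (k : (Fin n → Bool) → ℝ) (o : Option (Fin n → Bool)) :
    Continuous (fun t => acG k t o) := by
  cases o <;> simp only [acG] <;> fun_prop

theorem acF_cont {n : ℕ} (c : ℝ) (k : (Fin n → Bool) → ℝ) (o₁ o₂ o₃ : Option (Fin n → Bool)) :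
    Continuous (acF c k o₁ o₂ o₃) := by
  have h1 := acQ_cont c k
  have h2 := acG_cont k
  unfold acF
  fun_prop

theorem ac_ev {F : ℝ → ℝ} (hF : Continuous F) (h0 : 0 < F 0) : ∀ᶠ t in 𝓝[>] (0 : ℝ), 0 < F t :=
  (hF.continuousAt.eventually (lt_mem_nhds h0)).filter_mono nhdsWithin_le_nhds

theorem acF_symm {n : ℕ} (c : ℝ) (k : (Fin n → Bool) → ℝ) (o₁ o₂ o₃ : Option (Fin n → Bool)) :
    acF c k o₁ o₂ o₃ = acF c k o₃ o₂ o₁ := by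
  funext t
  simp only [acF, mul_comm]

theorem ac_key_aux {c a b u v w : ℝ} (ha : 1 ≤ a) (hb : 1 ≤ b) (hc : 0 < c)
    (hab : c * (a + b) ≤ 1 / 2) (hu : 0 < u) (hv : 0 < v) (hw : 0 < w)
    (hvu : v ≤ c / 3 * u) (hwu : w ≤ c / 3 * u) :
    0 < c * (a * (w ^ 2 - v ^ 2) + b * (u ^ 2 - v ^ 2)) + (u - v) * (w - v) := by
  have hc4 : c ≤ 1 / 4 := by nlinarith
  have h1 : v ^ 2 ≤ c ^ 2 / 9 * u ^ 2 := by nlinarith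
  have h2 : v ≤ u := by nlinarith
  have h3 : -(c / 3 * u ^ 2) ≤ (u - v) * (w - v) := by nlinarith
  have h4 : c * u ^ 2 ≤ c * b * u ^ 2 := by
    have : 0 ≤ c * u ^ 2 := by positivity
    nlinarith
  have h5 : c * (a + b) * v ^ 2 ≤ 1 / 2 * v ^ 2 := by gcongr
  have h6 : 0 ≤ c * a * w ^ 2 := by positivity
  have h7 : c ^ 2 * u ^ 2 ≤ c * u ^ 2 / 4 := by
    have : 0 ≤ c * u ^ 2 := by positivity
    nlinarith
  have h8 : 0 < c * u ^ 2 := by positivity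
  nlinarith

theorem ac_key {c a b u v w : ℝ} (ha : 1 ≤ a) (hb : 1 ≤ b) (hc : 0 < c)
    (hab : c * (a + b) ≤ 1 / 2) (hu : 0 < u) (hv : 0 < v) (hw : 0 < w)
    (huv : u ≤ c / 3 * v ∨ v ≤ c / 3 * u) (hvw : v ≤ c / 3 * w ∨ w ≤ c / 3 * v)
    (huw : u ≤ c / 3 * w ∨ w ≤ c / 3 * u) :
    0 < c * (a * (w ^ 2 - v ^ 2) + b * (u ^ 2 - v ^ 2)) + (u - v) * (w - v) := by
  have hc4 : c ≤ 1 / 4 := by nlinarith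
  have caseY : u ≤ c / 3 * v → w ≤ c / 3 * v →
      0 < c * (a * (w ^ 2 - v ^ 2) + b * (u ^ 2 - v ^ 2)) + (u - v) * (w - v) := by
    intro h1 h2
    have h3 : c * (a + b) * v ^ 2 ≤ 1 / 2 * v ^ 2 := by gcongr
    have h4 : 0 ≤ c * a * w ^ 2 := by positivity
    have h5 : 0 ≤ c * b * u ^ 2 := by positivity
    have h6 : u * v ≤ 1 / 12 * v ^ 2 := by nlinarith
    have h7 : w * v ≤ 1 / 12 * v ^ 2 := by nlinarith
    have h8 : 0 < u * w := by positivity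
    have h9 : 0 < v ^ 2 := by positivity
    nlinarith
  have caseX : v ≤ c / 3 * u → w ≤ c / 3 * u →
      0 < c * (a * (w ^ 2 - v ^ 2) + b * (u ^ 2 - v ^ 2)) + (u - v) * (w - v) :=
    ac_key_aux ha hb hc hab hu hv hw
  have caseZ : v ≤ c / 3 * w → u ≤ c / 3 * w →
      0 < c * (a * (w ^ 2 - v ^ 2) + b * (u ^ 2 - v ^ 2)) + (u - v) * (w - v) := by
    intro h1 h2
    have := ac_key_aux hb ha hc (by linarith) hw hv hu h1 h2
    nlinarith
  have tr : ∀ p q : ℝ, 0 < q → p ≤ c / 3 * q → p ≤ q := by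
    intro p q hq h
    nlinarith
  have c3 : 0 ≤ c / 3 := by positivity
  rcases huv with h1 | h1 <;> rcases hvw with h2 | h2
  · exact caseZ h2 (h1.trans (mul_le_mul_of_nonneg_left (tr _ _ hw h2) c3))
  · exact caseY h1 h2
  · rcases huw with h3 | h3
    · exact caseZ h2 h3
    · exact caseX h1 h3
  · exact caseX h1 (h2.trans (mul_le_mul_of_nonneg_left (tr _ _ hu h1) c3))

theorem acBit_cases (b : Bool) : acBit b = 0 ∨ acBit b = 1 := by
  cases b <;> simp [acBit]

theorem ac_cube {n : ℕ} {c : ℝ} {k : (Fin n → Bool) → ℝ} (hc : 0 < c) (hcn : c * n ≤ 1 / 2)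
    (hk : ∀ x, 0 < k x) (hkk : ∀ x y, x ≠ y → k x ≤ c / 3 * k y ∨ k y ≤ c / 3 * k x)
    (x y z : Fin n → Bool) (hxy : x ≠ y) (hyz : y ≠ z) (hxz : x ≠ z) :
    ∀ᶠ t in 𝓝[>] (0 : ℝ), 0 < acF c k (some x) (some y) (some z) t := by
  by_cases h : ∃ i, x i ≠ y i ∧ z i ≠ y i
  · apply ac_ev (acF_cont c k _ _ _)
    simp only [acF, acG, acQ]
    simp only [zero_mul, sub_zero, ne_eq, OfNat.ofNat_ne_zero, not_false_eq_true, zero_pow,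
      mul_zero, add_zero, zero_add]
    obtain ⟨i, h1, h2⟩ := h
    apply Finset.sum_pos'
    · intro j _
      cases x j <;> cases y j <;> cases z j <;> simp [acBit]
    · refine ⟨i, Finset.mem_univ _, ?_⟩
      revert h1 h2
      cases x i <;> cases y i <;> cases z i <;> simp [acBit]
  · push Not at h
    set a : ℝ := ∑ i, if x i ≠ y i then (1 : ℝ) else 0 with ha
    set b : ℝ := ∑ i, if z i ≠ y i then (1 : ℝ) else 0 with hb
    have cnt : ∀ p : Fin n → Bool, p ≠ y → 1 ≤ ∑ i, if p i ≠ y i then (1 : ℝ) else 0 := by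
      intro p hp
      obtain ⟨i, hi⟩ := Function.ne_iff.mp hp
      refine le_trans ?_ (Finset.single_le_sum (f := fun i => if p i ≠ y i then (1 : ℝ) else 0)
        (fun j _ => by positivity) (Finset.mem_univ i))
      simp [hi]
    have hab : a + b ≤ n := by
      rw [ha, hb, ← Finset.sum_add_distrib]
      calc _ ≤ ∑ i : Fin n, (1 : ℝ) := by
            apply Finset.sum_le_sum
            intro i _
            by_cases h1 : x i = y i
            · simp [h1]; split_ifs <;> norm_num
            · simp [h1, h i h1]
        _ = n := by simp
    have hA := ac_key (cnt x hxy) (cnt z hyz.symm) hc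
      (le_trans (mul_le_mul_of_nonneg_left hab hc.le) hcn) (hk x) (hk y) (hk z)
      (hkk x y hxy) (hkk y z hyz) (hkk x z hxz)
    rw [← ha, ← hb] at hA
    set C : ℝ := ∑ i, c ^ 2 * ((1 - 2 * acBit (x i)) * k x ^ 2 - (1 - 2 * acBit (y i)) * k y ^ 2) *
      ((1 - 2 * acBit (z i)) * k z ^ 2 - (1 - 2 * acBit (y i)) * k y ^ 2) with hC
    have key : ∀ t, acF c k (some x) (some y) (some z) t = t ^ 2 *
        ((c * (a * (k z ^ 2 - k y ^ 2) + b * (k x ^ 2 - k y ^ 2)) + (k x - k y) * (k z - k y))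
          + t ^ 2 * C) := by
      intro t
      have e : ∑ i, (acQ c k t (some x) i - acQ c k t (some y) i) *
          (acQ c k t (some z) i - acQ c k t (some y) i) =
          t ^ 2 * c * (a * (k z ^ 2 - k y ^ 2) + b * (k x ^ 2 - k y ^ 2)) + t ^ 2 * (t ^ 2 * C) := by
        rw [ha, hb, hC, Finset.sum_mul, Finset.sum_mul, ← Finset.sum_add_distrib, Finset.mul_sum,
          Finset.mul_sum, Finset.mul_sum, ← Finset.sum_add_distrib]
        apply Finset.sum_congr rfl
        intro i _
        have := h i
        revert this
        simp only [acQ]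
        cases x i <;> cases y i <;> cases z i <;> simp [acBit] <;> ring
      rw [acF, e]
      simp only [acG]
      ring
    have := ac_ev (F := fun t => (c * (a * (k z ^ 2 - k y ^ 2) + b * (k x ^ 2 - k y ^ 2))
      + (k x - k y) * (k z - k y)) + t ^ 2 * C) (by fun_prop) (by simpa using hA)
    filter_upwards [this, self_mem_nhdsWithin] with t h1 h2
    rw [key]
    have : 0 < t := h2
    positivity

theorem ac_apex_side {n : ℕ} (c : ℝ) (k : (Fin n → Bool) → ℝ) (y z : Fin n → Bool) (hyz : y ≠ z) :
    ∀ᶠ t in 𝓝[>] (0 : ℝ), 0 < acF c k none (some y) (some z) t := by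
  apply ac_ev (acF_cont c k _ _ _)
  simp only [acF, acG, acQ]
  simp only [zero_mul, sub_zero, ne_eq, OfNat.ofNat_ne_zero, not_false_eq_true, zero_pow,
      mul_zero, add_zero, zero_add]
  obtain ⟨i, h1⟩ := Function.ne_iff.mp hyz
  apply Finset.sum_pos'
  · intro j _
    cases y j <;> cases z j <;> norm_num [acBit]
  · refine ⟨i, Finset.mem_univ _, ?_⟩
    revert h1
    cases y i <;> cases z i <;> norm_num [acBit]

theorem ac_apex_top {n : ℕ} (c : ℝ) (k : (Fin n → Bool) → ℝ) (x z : Fin n → Bool) :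
    ∀ᶠ t in 𝓝[>] (0 : ℝ), 0 < acF c k (some x) none (some z) t := by
  apply ac_ev (acF_cont c k _ _ _)
  simp only [acF, acG, acQ]
  simp only [zero_mul, zero_sub, ne_eq, OfNat.ofNat_ne_zero, not_false_eq_true, zero_pow,
      mul_zero, add_zero]
  have : ∑ i : Fin n, (-(1 / 4) : ℝ) ≤
      ∑ i, (acBit (x i) - 1 / 2) * (acBit (z i) - 1 / 2) := by
    apply Finset.sum_le_sum
    intro i _
    cases x i <;> cases z i <;> norm_num [acBit]
  simp at this
  have hn : (0 : ℝ) ≤ n := Nat.cast_nonneg n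
  norm_num at this ⊢
  nlinarith

theorem ac_all {n : ℕ} {c : ℝ} {k : (Fin n → Bool) → ℝ} (hc : 0 < c) (hcn : c * n ≤ 1 / 2)
    (hk : ∀ x, 0 < k x) (hkk : ∀ x y, x ≠ y → k x ≤ c / 3 * k y ∨ k y ≤ c / 3 * k x)
    (x y z : Option (Fin n → Bool)) (hxy : x ≠ y) (hyz : y ≠ z) (hxz : x ≠ z) :
    ∀ᶠ t in 𝓝[>] (0 : ℝ), 0 < acF c k x y z t := by
  rcases x with _ | x <;> rcases y with _ | y <;> rcases z with _ | z <;> try contradiction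
  · exact ac_apex_side c k y z (by simpa using hyz)
  · exact ac_apex_top c k x z
  · rw [acF_symm]
    exact ac_apex_side c k y x (by simpa using hxy.symm)
  · exact ac_cube hc hcn hk hkk x y z (by simpa using hxy) (by simpa using hyz) (by simpa using hxz)

/-- Separated heights. -/
theorem ac_heights (n : ℕ) {c : ℝ} (hc : 0 < c) (hc1 : c ≤ 1) : ∃ k : (Fin n → Bool) → ℝ,
    (∀ x, 0 < k x) ∧ (∀ x y, x ≠ y → k x ≤ c / 3 * k y ∨ k y ≤ c / 3 * k x) := by
  let e := Fintype.equivFin (Fin n → Bool)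
  have h : ∀ p q : ℕ, p < q → (c / 3) ^ q ≤ c / 3 * (c / 3) ^ p := by
    intro p q hpq
    rw [← pow_succ']
    exact pow_le_pow_of_le_one (by positivity) (by linarith) hpq
  refine ⟨fun x => (c / 3) ^ (e x : ℕ), fun x => by positivity, fun x y hxy => ?_⟩
  have : (e x : ℕ) ≠ e y := fun h => hxy (e.injective (Fin.ext h))
  rcases lt_or_gt_of_ne this with h1 | h1
  · exact Or.inr (h _ _ h1)
  · exact Or.inl (h _ _ h1)

/-- The perturbed points. -/
noncomputable def acP {n : ℕ} (c : ℝ) (k : (Fin n → Bool) → ℝ) (t : ℝ)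
    (o : Option (Fin n → Bool)) : EuclideanSpace ℝ (Fin (n + 1)) :=
  WithLp.toLp 2 (Fin.cons (acG k t o) (acQ c k t o))

theorem acP_inner {n : ℕ} (c : ℝ) (k : (Fin n → Bool) → ℝ) (t : ℝ)
    (x y z : Option (Fin n → Bool)) :
    inner ℝ (acP c k t x - acP c k t y) (acP c k t z - acP c k t y) = acF c k x y z t := by
  simp [acP, acF, PiLp.inner_apply, Fin.sum_univ_succ, mul_comm]

/-- **Acute sets of exponentially optimal size.**
For every dimension `d ≥ 1` there exist `2^(d-1) + 1` points in `ℝ^d` such that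
any three of them form an acute triangle. -/
theorem exists_acute_set_of_card_two_pow_pred_add_one (d : ℕ) (hd : 1 ≤ d) :
    ∃ S : Finset (EuclideanSpace ℝ (Fin d)),
      S.card = 2 ^ (d - 1) + 1 ∧
      ∀ x ∈ S, ∀ y ∈ S, ∀ z ∈ S, x ≠ y → y ≠ z → x ≠ z →
        EuclideanGeometry.angle x y z < Real.pi / 2 := by
  obtain ⟨n, rfl⟩ : ∃ n, d = n + 1 := ⟨d - 1, by omega⟩
  set c : ℝ := 1 / (2 * (n + 1)) with hcdef
  have hc : 0 < c := by positivity
  have hn : (0 : ℝ) ≤ n := Nat.cast_nonneg n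
  have hc' : c * (n + 1) = 1 / 2 := by rw [hcdef]; field_simp
  have hcn : c * n ≤ 1 / 2 := by nlinarith
  have hc1 : c ≤ 1 := by nlinarith
  obtain ⟨k, hk, hkk⟩ := ac_heights n hc hc1
  have ev1 : ∀ᶠ t in 𝓝[>] (0 : ℝ), ∀ x y z : Option (Fin n → Bool), x ≠ y → y ≠ z → x ≠ z →
      0 < acF c k x y z t := by
    simp only [eventually_all]
    exact fun x y z h1 h2 h3 => ac_all hc hcn hk hkk x y z h1 h2 h3
  have ev2 : ∀ᶠ t in 𝓝[>] (0 : ℝ), ∀ x : Fin n → Bool, 0 < (n : ℝ) + 1 - t * k x := by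
    simp only [eventually_all]
    intro x
    exact ac_ev (F := fun t => (n : ℝ) + 1 - t * k x) (by fun_prop) (by simp; positivity)
  obtain ⟨t, ⟨h1, h2⟩, h3⟩ := ((ev1.and ev2).and self_mem_nhdsWithin).exists
  have ht : 0 < t := h3
  have hkinj : ∀ x y, k x = k y → x = y := by
    intro x y h
    by_contra hne
    have := hk x
    have := hk y
    rcases hkk x y hne with h' | h' <;> rw [h] at h' <;> nlinarith
  have hinj : Function.Injective (acP c k t) := by
    intro x y hxy
    have h0 : acG k t x = acG k t y := by
      have := congrArg (fun v : EuclideanSpace ℝ (Fin (n + 1)) => v 0) hxy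
      simpa [acP] using this
    rcases x with _ | x <;> rcases y with _ | y <;> simp only [acG] at h0
    · rfl
    · linarith [h2 y]
    · linarith [h2 x]
    · rw [hkinj x y (mul_left_cancel₀ ht.ne' h0)]
  refine ⟨Finset.univ.map ⟨acP c k t, hinj⟩, by simp, ?_⟩
  intro x hx y hy z hz hxy hyz hxz
  simp only [Finset.mem_map, Finset.mem_univ, true_and, Function.Embedding.coeFn_mk] at hx hy hz
  obtain ⟨x, rfl⟩ := hx
  obtain ⟨y, rfl⟩ := hy
  obtain ⟨z, rfl⟩ := hz
  have hpos := h1 x y z (fun h => hxy (h ▸ rfl)) (fun h => hyz (h ▸ rfl)) (fun h => hxz (h ▸ rfl))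
  rw [← acP_inner] at hpos
  unfold EuclideanGeometry.angle InnerProductGeometry.angle
  rw [Real.arccos_lt_pi_div_two]
  simp only [vsub_eq_sub]
  have hx0 : 0 < ‖acP c k t x - acP c k t y‖ := norm_pos_iff.mpr (sub_ne_zero.mpr hxy)
  have hz0 : 0 < ‖acP c k t z - acP c k t y‖ := norm_pos_iff.mpr (sub_ne_zero.mpr hyz.symm)
  positivity
end

section
/- For every dimension d ≥ 1 there exists a strictly antipodal set in ℝ^d of cardinality 2^{d-1}+1. -/
/-- The sign attached to a Boolean. -/
def antiSg (b : Bool) : ℝ := if b then 1 else -1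

/-- Apex-or-perturbed-cube points. -/
noncomputable def antiPt (n : ℕ) (t : ℝ) (r : (Fin n → Bool) → ℕ) :
    Option (Fin n → Bool) → EuclideanSpace ℝ (Fin (n + 1))
  | none => WithLp.toLp 2 (Fin.cons ((n : ℝ) + 2) (fun _ => 0))
  | some v => WithLp.toLp 2 (Fin.cons (t ^ (2 * r v + 2))
      (fun i => (1 - t ^ (4 * r v + 5)) * antiSg (v i)))

lemma anti_sum_lower {n : ℕ} (T : Fin n → ℝ) (m M : ℝ) (hm : 0 ≤ m) (h : ∀ k, -m ≤ T k)
    (i : Fin n) (hi : M ≤ T i) : M - n * m ≤ ∑ k, T k := by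
  rw [← Finset.add_sum_erase _ _ (Finset.mem_univ i)]
  have h1 : ∑ k ∈ Finset.univ.erase i, (-m) ≤ ∑ k ∈ Finset.univ.erase i, T k :=
    Finset.sum_le_sum fun k _ => h k
  have h2 : ((Finset.univ.erase i).card : ℝ) ≤ n := by
    have : (Finset.univ.erase i).card ≤ n := by
      simpa using Finset.card_le_univ (Finset.univ.erase i)
    exact_mod_cast this
  rw [Finset.sum_const, nsmul_eq_mul] at h1
  nlinarith

lemma anti_sum_lower' {n : ℕ} (T : Fin n → ℝ) (m : ℝ) (h : ∀ k, -m ≤ T k) :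
    - (n * m) ≤ ∑ k, T k := by
  have h1 : ∑ k : Fin n, (-m) ≤ ∑ k, T k := Finset.sum_le_sum fun k _ => h k
  simp at h1
  linarith

/-- The coordinate term. -/
def antiT (a a' a'' : ℝ) (x y z : Bool) : ℝ :=
  (a' * antiSg y - a * antiSg x) * (a'' * antiSg z - a * antiSg x)

lemma antiT_neither (a a' a'' : ℝ) (x : Bool) : antiT a a' a'' x x x = (a' - a) * (a'' - a) := by
  cases x <;> simp [antiT, antiSg] <;> ring
lemma antiT_D (a a' a'' : ℝ) (x y : Bool) (h : y ≠ x) :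
    antiT a a' a'' x y x = (a + a') * (a - a'') := by
  cases x <;> cases y <;> simp [antiT, antiSg] at h ⊢ <;> ring
lemma antiT_E (a a' a'' : ℝ) (x z : Bool) (h : z ≠ x) :
    antiT a a' a'' x x z = (a + a'') * (a - a') := by
  cases x <;> cases z <;> simp [antiT, antiSg] at h ⊢ <;> ring
lemma antiT_both (a a' a'' : ℝ) (x y z : Bool) (h : y ≠ x) (h' : z ≠ x) :
    antiT a a' a'' x y z = (a + a') * (a + a'') := by
  cases x <;> cases y <;> cases z <;> simp [antiT, antiSg] at h h' ⊢ <;> ring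

lemma antiT_split (a a' a'' : ℝ) (x y z : Bool) (P : ℝ → Prop)
    (h1 : P ((a' - a) * (a'' - a))) (h2 : P ((a + a') * (a - a'')))
    (h3 : P ((a + a'') * (a - a'))) (h4 : y ≠ x → z ≠ x → P ((a + a') * (a + a''))) :
    P (antiT a a' a'' x y z) := by
  by_cases hy : y = x <;> by_cases hz : z = x
  · subst hy; subst hz; rwa [antiT_neither]
  · subst hy; rwa [antiT_E _ _ _ _ _ hz]
  · subst hz; rwa [antiT_D _ _ _ _ _ hy]
  · rw [antiT_both _ _ _ _ _ _ hy hz]; exact h4 hy hz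

set_option maxHeartbeats 4000000 in
/-- Abstract acute estimate. -/
lemma anti_key {n : ℕ} (t : ℝ) (ht : 0 < t) (htn : 100 * ((n : ℝ) + 1) * t ≤ 1)
    (r : (Fin n → Bool) → ℕ) (hr : Function.Injective r) (φ b : (Fin n → Bool) → ℝ)
    (hφ0 : ∀ v, 0 < φ v) (hφt : ∀ v, φ v ≤ t) (hb0 : ∀ v, 0 < b v) (hbt : ∀ v, b v ≤ t)
    (hφb : ∀ v, φ v = t * (b v) ^ 2)
    (hφφ : ∀ v w, r v < r w → φ w ≤ t * φ v) (hbb : ∀ v w, r v < r w → b w ≤ t * b v)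
    (hbbφ : ∀ v w, r v < r w → b v * b w ≤ t * φ v)
    (x y z : Fin n → Bool) (hxy : y ≠ x) (hxz : z ≠ x) :
    0 < (b y - b x) * (b z - b x) +
      ∑ i, antiT (1 - φ x) (1 - φ y) (1 - φ z) (x i) (y i) (z i) := by
  have hn0 : (0 : ℝ) ≤ n := Nat.cast_nonneg n
  have ht1 : t ≤ 1 / 100 := by nlinarith
  have hnt : (n : ℝ) * t ≤ 1 / 100 := by nlinarith
  have px := hφ0 x
  have py := hφ0 y
  have pz := hφ0 z
  have qx := hφt x
  have qy := hφt y
  have qz := hφt z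
  have bx := hb0 x
  have b_y := hb0 y
  have bz := hb0 z
  by_cases hboth : ∃ i, y i ≠ x i ∧ z i ≠ x i
  · obtain ⟨i, hi, hi'⟩ := hboth
    have h := anti_sum_lower (fun i => antiT (1 - φ x) (1 - φ y) (1 - φ z) (x i) (y i) (z i))
      (2 * t) 1 (by positivity) (fun k => by
        apply antiT_split _ _ _ _ _ _ (fun s => -(2 * t) ≤ s)
        · nlinarith
        · nlinarith
        · nlinarith
        · intro _ _; nlinarith) i (by
        rw [antiT_both _ _ _ _ _ _ hi hi']
        nlinarith)
    have := hbt x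
    have := hbt y
    have := hbt z
    have : -(t * 1) ≤ (b y - b x) * (b z - b x) := by nlinarith
    nlinarith
  · have hno : ∀ i, y i ≠ x i → z i ≠ x i → False := fun i h1 h2 => hboth ⟨i, h1, h2⟩
    obtain ⟨iy, hiy⟩ := Function.ne_iff.1 hxy
    obtain ⟨iz, hiz⟩ := Function.ne_iff.1 hxz
    have hyx : y iz = x iz := by by_contra h; exact hno _ h hiz
    have hzx : z iy = x iy := by by_contra h; exact hno _ hiy h
    have nφ : (n : ℝ) * φ x ≤ n * t * 1 := by nlinarith
    rcases lt_or_gt_of_ne (fun h => hxy (hr h) : r y ≠ r x) with hy | hy <;>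
    rcases lt_or_gt_of_ne (fun h => hxz (hr h) : r z ≠ r x) with hz | hz
    · have e1 := hφφ _ _ hy
      have e2 := hφφ _ _ hz
      have e3 := hbb _ _ hy
      have e4 := hbb _ _ hz
      have f1 : φ x < φ y := by nlinarith
      have f2 : φ x < φ z := by nlinarith
      have f3 : b x < b y := by nlinarith
      have f4 : b x < b z := by nlinarith
      have h := anti_sum_lower' (fun i => antiT (1 - φ x) (1 - φ y) (1 - φ z) (x i) (y i) (z i)) 0
        (fun k => by
        apply antiT_split _ _ _ _ _ _ (fun s => -0 ≤ s)
        · nlinarith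
        · nlinarith
        · nlinarith
        · intro h1 h2; exact (hno _ h1 h2).elim)
      have : 0 < (b y - b x) * (b z - b x) := mul_pos (by linarith) (by linarith)
      linarith
    · have e1 := hφφ _ _ hy
      have e2 := hφφ _ _ hz
      have e3 := hbb _ _ hy
      have e4 := hbb _ _ hz
      have e5 := hbbφ _ _ hy
      have f1 : φ x < φ y := by nlinarith
      have f2 : φ z < φ x := by nlinarith
      have f3 : b x < b y := by nlinarith
      have f4 : b z < b x := by nlinarith
      have h := anti_sum_lower (fun i => antiT (1 - φ x) (1 - φ y) (1 - φ z) (x i) (y i) (z i))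
        (2 * φ x) (φ y - φ x) (by positivity) (fun k => by
        apply antiT_split _ _ _ _ _ _ (fun s => -(2 * φ x) ≤ s)
        · nlinarith
        · nlinarith
        · nlinarith
        · intro h1 h2; exact (hno _ h1 h2).elim) iz (by
        rw [hyx, antiT_E _ _ _ _ _ hiz]
        nlinarith)
      have g1 : -(b y * b x) ≤ (b y - b x) * (b z - b x) := by nlinarith
      have g2 : (n : ℝ) * φ x ≤ (n * t) * φ y := by nlinarith
      have g3 : (n * t) * φ y ≤ 1 / 100 * φ y := by nlinarith
      have g4 : t * φ y ≤ 1 / 100 * φ y := by nlinarith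
      linarith
    · have e1 := hφφ _ _ hy
      have e2 := hφφ _ _ hz
      have e3 := hbb _ _ hy
      have e4 := hbb _ _ hz
      have e5 := hbbφ _ _ hz
      have f1 : φ y < φ x := by nlinarith
      have f2 : φ x < φ z := by nlinarith
      have f3 : b y < b x := by nlinarith
      have f4 : b x < b z := by nlinarith
      have h := anti_sum_lower (fun i => antiT (1 - φ x) (1 - φ y) (1 - φ z) (x i) (y i) (z i))
        (2 * φ x) (φ z - φ x) (by positivity) (fun k => by
        apply antiT_split _ _ _ _ _ _ (fun s => -(2 * φ x) ≤ s)
        · nlinarith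
        · nlinarith
        · nlinarith
        · intro h1 h2; exact (hno _ h1 h2).elim) iy (by
        rw [hzx, antiT_D _ _ _ _ _ hiy]
        nlinarith)
      have g1 : -(b z * b x) ≤ (b y - b x) * (b z - b x) := by nlinarith
      have g2 : (n : ℝ) * φ x ≤ (n * t) * φ z := by nlinarith
      have g3 : (n * t) * φ z ≤ 1 / 100 * φ z := by nlinarith
      have g4 : t * φ z ≤ 1 / 100 * φ z := by nlinarith
      linarith
    · have e1 := hφφ _ _ hy
      have e2 := hφφ _ _ hz
      have e3 := hbb _ _ hy
      have e4 := hbb _ _ hz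
      have f1 : φ y < φ x := by nlinarith
      have f2 : φ z < φ x := by nlinarith
      have h := anti_sum_lower' (fun i => antiT (1 - φ x) (1 - φ y) (1 - φ z) (x i) (y i) (z i))
        (2 * φ x) (fun k => by
        apply antiT_split _ _ _ _ _ _ (fun s => -(2 * φ x) ≤ s)
        · nlinarith
        · nlinarith
        · nlinarith
        · intro h1 h2; exact (hno _ h1 h2).elim)
      have g1 : 1 / 2 * b x ≤ b x - b y := by nlinarith
      have g2 : 1 / 2 * b x ≤ b x - b z := by nlinarith
      have g3 : (1 / 2 * b x) * (1 / 2 * b x) ≤ (b x - b y) * (b x - b z) :=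
        mul_le_mul g1 g2 (by positivity) (by linarith)
      have g4 : (n : ℝ) * φ x = (n * t) * (b x) ^ 2 := by rw [hφb]; ring
      have g5 : (n * t) * (b x) ^ 2 ≤ 1 / 100 * (b x) ^ 2 := by nlinarith [sq_nonneg (b x)]
      have g6 : 0 < (b x) ^ 2 := by positivity
      nlinarith

lemma anti_inner_cons {n : ℕ} (p q s : ℝ) (u v w : Fin n → ℝ) :
    inner ℝ ((WithLp.toLp 2 (Fin.cons q v) : EuclideanSpace ℝ (Fin (n + 1))) -
        WithLp.toLp 2 (Fin.cons p u))
      ((WithLp.toLp 2 (Fin.cons s w) : EuclideanSpace ℝ (Fin (n + 1))) -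
        WithLp.toLp 2 (Fin.cons p u)) =
    (q - p) * (s - p) + ∑ i, (v i - u i) * (w i - u i) := by
  simp [PiLp.inner_apply, Fin.sum_univ_succ, mul_comm]

lemma anti_acute {n : ℕ} (t : ℝ) (ht : 0 < t) (htn : 100 * ((n : ℝ) + 1) ^ 2 * t ≤ 1)
    (r : (Fin n → Bool) → ℕ) (hr : Function.Injective r)
    (x y z : Option (Fin n → Bool)) (hxy : y ≠ x) (hxz : z ≠ x) (hyz : y ≠ z ∨ y ≠ none) :
    0 < inner ℝ (antiPt n t r y - antiPt n t r x) (antiPt n t r z - antiPt n t r x) := by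
  have hn0 : (0 : ℝ) ≤ n := Nat.cast_nonneg n
  have htn' : 100 * ((n : ℝ) + 1) * t ≤ 1 := by nlinarith [mul_nonneg hn0 ht.le]
  have ht1 : t ≤ 1 / 100 := by nlinarith
  have hnt : (n : ℝ) * t ≤ 1 / 100 := by nlinarith
  have hpow : ∀ k, t ^ (k + 1) ≤ t := fun k => by
    simpa using pow_le_pow_of_le_one ht.le (by linarith) (Nat.le_add_left 1 k)
  have hple : ∀ {k l : ℕ}, k ≤ l → t ^ l ≤ t ^ k := fun h =>
    pow_le_pow_of_le_one ht.le (by linarith) h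
  -- an estimate for the angle at a cube vertex towards the apex
  have hA : ∀ u v : Fin n → Bool, v ≠ u →
      0 < (t ^ (2 * r v + 2) - t ^ (2 * r u + 2)) * ((n : ℝ) + 2 - t ^ (2 * r u + 2)) +
        ∑ i, ((1 - t ^ (4 * r v + 5)) * antiSg (v i) - (1 - t ^ (4 * r u + 5)) * antiSg (u i)) *
          (0 - (1 - t ^ (4 * r u + 5)) * antiSg (u i)) := by
    intro u v huv
    obtain ⟨i, hi⟩ := Function.ne_iff.1 huv
    have a1 := hpow (4 * r v + 4)
    have a2 := hpow (4 * r u + 4)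
    have a3 := hpow (2 * r v + 1)
    have a4 := hpow (2 * r u + 1)
    have c1 : 0 < t ^ (4 * r v + 5) := by positivity
    have c2 : 0 < t ^ (4 * r u + 5) := by positivity
    have c3 : 0 < t ^ (2 * r v + 2) := by positivity
    have c4 : 0 < t ^ (2 * r u + 2) := by positivity
    simp only [Nat.add_assoc, Nat.reduceAdd] at a1 a2 a3 a4
    generalize t ^ (4 * r v + 5) = A at *
    generalize t ^ (4 * r u + 5) = B at *
    generalize t ^ (2 * r v + 2) = C at *
    generalize t ^ (2 * r u + 2) = D at *
    have h := anti_sum_lower (fun i => ((1 - A) * antiSg (v i) - (1 - B) * antiSg (u i)) *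
          (0 - (1 - B) * antiSg (u i))) t 1 ht.le (fun k => by
        cases hu : u k <;> cases hv : v k <;> simp [antiSg] <;> nlinarith) i (by
        cases hu : u i <;> cases hv : v i <;> simp [antiSg, hu, hv] at hi ⊢ <;> nlinarith)
    have : -(t * (n + 2)) ≤ (C - D) * ((n : ℝ) + 2 - D) := by nlinarith
    nlinarith
  rcases x with _ | x
  · rcases y with _ | y
    · exact (hxy rfl).elim
    rcases z with _ | z
    · exact (hxz rfl).elim
    simp only [antiPt]
    rw [anti_inner_cons]
    have a1 := hpow (4 * r y + 4)
    have a2 := hpow (4 * r z + 4)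
    have a3 := hpow (2 * r y + 1)
    have a4 := hpow (2 * r z + 1)
    have c1 : 0 < t ^ (4 * r y + 5) := by positivity
    have c2 : 0 < t ^ (4 * r z + 5) := by positivity
    simp only [Nat.add_assoc, Nat.reduceAdd] at a1 a2 a3 a4
    generalize t ^ (4 * r y + 5) = A at *
    generalize t ^ (4 * r z + 5) = B at *
    generalize t ^ (2 * r y + 2) = C at *
    generalize t ^ (2 * r z + 2) = D at *
    have h := anti_sum_lower' (fun i => ((1 - A) * antiSg (y i) - 0) * ((1 - B) * antiSg (z i) - 0))
      1 (fun k => by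
        cases hu : y k <;> cases hv : z k <;> simp [antiSg] <;> nlinarith)
    have : ((n : ℝ) + 1) * (n + 1) ≤ (n + 2 - C) * (n + 2 - D) :=
      mul_le_mul (by linarith) (by linarith) (by linarith) (by linarith)
    nlinarith
  · rcases y with _ | y
    · rcases z with _ | z
      · simp at hyz
      simp only [antiPt]
      rw [real_inner_comm, anti_inner_cons]
      exact hA x z (fun h => hxz (by rw [h]))
    · rcases z with _ | z
      · simp only [antiPt]
        rw [anti_inner_cons]
        exact hA x y (fun h => hxy (by rw [h]))
      simp only [antiPt]
      rw [anti_inner_cons]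
      refine anti_key t ht htn' r hr (fun v => t ^ (4 * r v + 5)) (fun v => t ^ (2 * r v + 2))
        (fun v => by positivity) (fun v => hpow _) (fun v => by positivity) (fun v => hpow _)
        (fun v => by ring) (fun v w h => ?_) (fun v w h => ?_) (fun v w h => ?_) x y z
        (fun h => hxy (by rw [h])) (fun h => hxz (by rw [h]))
      · simp only [← pow_succ']; exact hple (by omega)
      · simp only [← pow_succ']; exact hple (by omega)
      · simp only [← pow_succ', ← pow_add]; exact hple (by omega)

/-- For every dimension `d ≥ 1` there exists a strictly antipodal set in `ℝ^d`
of cardinality `2^(d-1) + 1`.  A set `S` is strictly antipodal if for any two distinct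
points `x, y ∈ S` there is a nonzero linear functional `f` with `f x ≠ f y` such that
every other point of `S` lies strictly between the level hyperplanes through `x` and `y`. -/
theorem exists_strictly_antipodal_set_of_card_two_pow_pred_add_one (d : ℕ) (hd : 1 ≤ d) :
    ∃ S : Finset (EuclideanSpace ℝ (Fin d)),
      S.card = 2 ^ (d - 1) + 1 ∧
      ∀ x ∈ S, ∀ y ∈ S, x ≠ y →
        ∃ f : EuclideanSpace ℝ (Fin d) →ₗ[ℝ] ℝ, f ≠ 0 ∧ f x ≠ f y ∧
          ∀ z ∈ S, z ≠ x → z ≠ y →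
            min (f x) (f y) < f z ∧ f z < max (f x) (f y) := by
  obtain ⟨n, rfl⟩ : ∃ n, d = n + 1 := ⟨d - 1, by omega⟩
  let r : (Fin n → Bool) → ℕ := fun v => (Fintype.equivFin (Fin n → Bool) v : ℕ)
  have hr : Function.Injective r := fun a b h =>
    (Fintype.equivFin (Fin n → Bool)).injective (Fin.ext h)
  let t : ℝ := 1 / (100 * ((n : ℝ) + 1) ^ 2)
  have ht : 0 < t := by positivity
  have htn : 100 * ((n : ℝ) + 1) ^ 2 * t ≤ 1 := by
    simp only [t]
    rw [mul_one_div_cancel (by positivity)]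
  have key := anti_acute t ht htn r hr
  have hinj : Function.Injective (antiPt n t r) := by
    intro a b h
    by_contra hab
    rcases a with _ | a
    · rcases b with _ | b
      · exact hab rfl
      have := key none (some b) (some b) (by simp) (by simp) (Or.inr (by simp))
      rw [h] at this
      simp at this
    · have := key b (some a) (some a) hab hab (Or.inr (by simp))
      rw [h] at this
      simp at this
  refine ⟨Finset.univ.map ⟨antiPt n t r, hinj⟩, by simp, ?_⟩
  intro x hx y hy hxy
  obtain ⟨x, -, rfl⟩ := Finset.mem_map.1 hx
  obtain ⟨y, -, rfl⟩ := Finset.mem_map.1 hy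
  simp only [Function.Embedding.coeFn_mk] at hxy ⊢
  have hxy' : x ≠ y := fun h => hxy (by rw [h])
  set X := antiPt n t r x with hX
  set Y := antiPt n t r y with hY
  have hpos : 0 < inner ℝ (Y - X) (Y - X) := by
    rw [real_inner_self_eq_norm_sq]
    have : 0 < ‖Y - X‖ := norm_pos_iff.2 (sub_ne_zero.2 hxy.symm)
    positivity
  have hlt : inner ℝ (Y - X) X < inner ℝ (Y - X) Y := by
    rw [inner_sub_right (Y - X) Y X] at hpos
    linarith
  refine ⟨(innerSL ℝ (Y - X)).toLinearMap, ?_, ?_, ?_⟩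
  · intro h
    have := LinearMap.congr_fun h (Y - X)
    simp only [ContinuousLinearMap.coe_coe, innerSL_apply_apply, LinearMap.zero_apply] at this
    linarith
  · exact hlt.ne
  · intro z hz hzx hzy
    obtain ⟨z, -, rfl⟩ := Finset.mem_map.1 hz
    simp only [Function.Embedding.coeFn_mk] at hzx hzy ⊢
    have hzx' : z ≠ x := fun h => hzx (by rw [h])
    have hzy' : z ≠ y := fun h => hzy (by rw [h])
    simp only [ContinuousLinearMap.coe_coe, innerSL_apply_apply]
    rw [min_eq_left hlt.le, max_eq_right hlt.le]
    have k1 := key x y z hxy'.symm hzx' (Or.inl hzy'.symm)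
    have k2 := key y x z hxy' hzy' (Or.inl hzx'.symm)
    rw [← hX, ← hY, inner_sub_right] at k1
    rw [← hX, ← hY, ← neg_sub Y X, inner_neg_left, inner_sub_right] at k2
    constructor <;> linarith
end

section
/- Let X = {0,1}^{d−1} × {0} ⊂ ℝ^d be the vertex set of a (d−1)-dimensional hypercube. For every δ > 0 there exists a map x ↦ x' assigning to each vertex x ∈ X a point x' ∈ ℝ^d with |x − x'| ≤ δ, such that the resulting 2^{d−1} points {x' : x ∈ X} form an acute set (in particular the map is injective). -/
/-- The vertex set `{0,1}^(d-1) × {0}` of the `(d-1)`-dimensional unit hypercube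
embedded in `ℝ^d` with last coordinate `0`. -/
def hypercube (d : ℕ) : Set (EuclideanSpace ℝ (Fin d)) :=
  {v | ∀ i : Fin d, if (i : ℕ) = d - 1 then v i = 0 else v i = 0 ∨ v i = 1}

/-- The product of the `i`-th coordinates of the two difference vectors. -/
def acuteTerm (x y z a b c : ℝ) : ℝ :=
  ((x + a * (1 - 2 * x)) - (y + b * (1 - 2 * y))) * ((z + c * (1 - 2 * z)) - (y + b * (1 - 2 * y)))

theorem acuteTerm_swap (x y z a b c : ℝ) : acuteTerm x y z a b c = acuteTerm z y x c b a := by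
  unfold acuteTerm; ring

theorem acuteTerm_lower {x y z a b c M : ℝ} (hx : x = 0 ∨ x = 1) (hy : y = 0 ∨ y = 1)
    (hz : z = 0 ∨ z = 1) (ha : 0 ≤ a) (hb : 0 ≤ b) (hc : 0 ≤ c)
    (ha' : a ≤ 1 / 10) (hb' : b ≤ 1 / 10) (hc' : c ≤ 1 / 10) (hM : 0 ≤ M)
    (h1 : x = y ∨ b - c ≤ M) (h2 : z = y ∨ b - a ≤ M)
    (h3 : -M ≤ (a - b) * (c - b)) : -M ≤ acuteTerm x y z a b c := by
  unfold acuteTerm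
  rcases hx with rfl | rfl <;> rcases hy with rfl | rfl <;> rcases hz with rfl | rfl <;>
    norm_num at h1 h2 ⊢ <;> nlinarith

theorem acuteTerm_both {x y z a b c : ℝ} (hx : x = 0 ∨ x = 1) (hy : y = 0 ∨ y = 1)
    (hz : z = 0 ∨ z = 1) (ha : 0 ≤ a) (hb : 0 ≤ b) (hc : 0 ≤ c)
    (ha' : a ≤ 1 / 10) (hb' : b ≤ 1 / 10) (hc' : c ≤ 1 / 10)
    (h1 : x ≠ y) (h2 : z ≠ y) : 1 / 2 ≤ acuteTerm x y z a b c := by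
  unfold acuteTerm
  rcases hx with rfl | rfl <;> rcases hy with rfl | rfl <;> rcases hz with rfl | rfl <;>
    first
    | exact absurd rfl h2
    | exact absurd rfl h1
    | (exfalso; norm_num at h1; done)
    | nlinarith

theorem acuteTerm_one {x y z a b c : ℝ} (hx : x = 0 ∨ x = 1) (hy : y = 0 ∨ y = 1)
    (hz : z = 0 ∨ z = 1) (hb : 0 ≤ b) (hc : 0 ≤ c)
    (hb' : b ≤ 1 / 10) (hc' : c ≤ 1 / 10) (hab : b ≤ a)
    (h1 : x = y) (h2 : z ≠ y) : (4 / 5) * (a - b) ≤ acuteTerm x y z a b c := by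
  unfold acuteTerm
  rcases hx with rfl | rfl <;> rcases hy with rfl | rfl <;> rcases hz with rfl | rfl <;>
    first
    | exact absurd rfl h2
    | exact absurd rfl h1
    | (exfalso; norm_num at h1; done)
    | nlinarith

theorem sum_lower {n : ℕ} (T : Fin n → ℝ) (M K : ℝ) (i₀ : Fin n) (hM : 0 ≤ M)
    (hT : ∀ i, -M ≤ T i) (hK : K ≤ T i₀) : K - n * M ≤ ∑ i, T i := by
  have h := Finset.single_le_sum (f := fun i => T i + M) (s := Finset.univ)
    (fun i _ => by have := hT i; linarith) (Finset.mem_univ i₀)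
  simp only [Finset.sum_add_distrib, Finset.sum_const, Finset.card_univ, Fintype.card_fin,
    nsmul_eq_mul] at h
  linarith

theorem key_big_x {n : ℕ} (x y z : Fin n → ℝ) (hx : ∀ i, x i = 0 ∨ x i = 1)
    (hy : ∀ i, y i = 0 ∨ y i = 1) (hz : ∀ i, z i = 0 ∨ z i = 1) (hzy : ∃ i, z i ≠ y i)
    (hno : ∀ i, x i = y i ∨ z i = y i)
    (a b c : ℝ) (ha : 0 < a) (hb : 0 < b) (hc : 0 < c) (han : ((n : ℝ) + 1) * a ≤ 1 / 10)
    (hba : b ≤ a ^ 4) (hca : c ≤ a ^ 4) :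
    0 < ∑ i, acuteTerm (x i) (y i) (z i) (a ^ 3) (b ^ 3) (c ^ 3) + (a - b) * (c - b) := by
  obtain ⟨i₀, hi₀⟩ := hzy
  have hn : (0 : ℝ) ≤ n := Nat.cast_nonneg n
  have ha1 : a ≤ 1 / 10 := by nlinarith
  have ha2 : a ^ 2 ≤ 1 / 100 := by nlinarith
  have ha3 : a ^ 3 ≤ 1 / 1000 := by
    have : a ^ 3 = a ^ 2 * a := by ring
    nlinarith
  have ha3p : 0 < a ^ 3 := by positivity
  have h4 : a ^ 4 ≤ a * (1 / 1000) := by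
    have : a ^ 4 = a * a ^ 3 := by ring
    rw [this]; gcongr
  have hb1 : b ≤ 1 / 10 := by linarith
  have hc1 : c ≤ 1 / 10 := by linarith
  have h5 : a * a ^ 4 = a ^ 3 * a ^ 2 := by ring
  have cube : ∀ t : ℝ, 0 < t → t ≤ a ^ 4 → t ^ 3 ≤ a ^ 5 := by
    intro t ht hta
    have e1 : t ≤ a := by linarith
    have e2 : t ^ 3 = t * t * t := by ring
    have e3 : t * t ≤ a ^ 4 * a := by gcongr
    have e4 : t * t * t ≤ (a ^ 4 * a) * 1 := by
      gcongr; linarith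
    rw [e2]; calc t * t * t ≤ (a ^ 4 * a) * 1 := e4
      _ = a ^ 5 := by ring
  have hb3 := cube b hb hba
  have hc3 := cube c hc hca
  have hb3p : 0 < b ^ 3 := by positivity
  have hc3p : 0 < c ^ 3 := by positivity
  have h55 : a ^ 5 = a ^ 3 * a ^ 2 := by ring
  have h5s : a ^ 5 ≤ a ^ 3 * (1 / 100) := by rw [h55]; gcongr
  have h5p : 0 < a ^ 5 := by positivity
  have hS := sum_lower (fun i => acuteTerm (x i) (y i) (z i) (a ^ 3) (b ^ 3) (c ^ 3)) (a ^ 5)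
    ((4 / 5) * (a ^ 3 - b ^ 3)) i₀ h5p.le
    (fun i => acuteTerm_lower (hx i) (hy i) (hz i) ha3p.le hb3p.le hc3p.le
      (by linarith) (by linarith) (by linarith) h5p.le (Or.inr (by linarith))
      (Or.inr (by linarith)) (by nlinarith))
    (acuteTerm_one (hx i₀) (hy i₀) (hz i₀) hb3p.le hc3p.le (by linarith) (by linarith)
      (by linarith) ((hno i₀).resolve_right hi₀) hi₀)
  have hna : (n : ℝ) * a ^ 5 ≤ a ^ 3 * (1 / 100) := by
    have e : (n : ℝ) * a ^ 5 = a ^ 3 * ((n * a) * a) := by ring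
    rw [e]
    gcongr
    nlinarith
  have hh : -(a ^ 5) ≤ (a - b) * (c - b) := by
    have e1 : a * b ≤ a ^ 5 := by
      have : a ^ 5 = a * a ^ 4 := by ring
      rw [this]; gcongr
    have e2 : b ≤ a := by linarith
    have e3 : 0 ≤ (a - b) * c := mul_nonneg (by linarith) hc.le
    nlinarith [mul_pos hb hb]
  linarith

theorem key_big_y {n : ℕ} (x y z : Fin n → ℝ) (hx : ∀ i, x i = 0 ∨ x i = 1)
    (hy : ∀ i, y i = 0 ∨ y i = 1) (hz : ∀ i, z i = 0 ∨ z i = 1)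
    (a b c : ℝ) (ha : 0 < a) (hb : 0 < b) (hc : 0 < c) (hbn : ((n : ℝ) + 1) * b ≤ 1 / 10)
    (hab : a ≤ b ^ 4) (hcb : c ≤ b ^ 4) :
    0 < ∑ i, acuteTerm (x i) (y i) (z i) (a ^ 3) (b ^ 3) (c ^ 3) + (a - b) * (c - b) := by
  have hn : (0 : ℝ) ≤ n := Nat.cast_nonneg n
  have hb1 : b ≤ 1 / 10 := by nlinarith
  have hb2 : b ^ 2 ≤ 1 / 100 := by nlinarith
  have hb3 : b ^ 3 ≤ 1 / 1000 := by
    have : b ^ 3 = b ^ 2 * b := by ring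
    nlinarith
  have h4 : b ^ 4 ≤ b * (1 / 1000) := by
    have : b ^ 4 = b * b ^ 3 := by ring
    rw [this]; gcongr
  have hb3p : 0 < b ^ 3 := by positivity
  have ha3p : 0 < a ^ 3 := by positivity
  have hc3p : 0 < c ^ 3 := by positivity
  have ha3 : a ^ 3 ≤ b ^ 3 := by gcongr; linarith
  have hc3 : c ^ 3 ≤ b ^ 3 := by gcongr; linarith
  have hS : -(n * b ^ 3) ≤ ∑ i, acuteTerm (x i) (y i) (z i) (a ^ 3) (b ^ 3) (c ^ 3) := by
    have := Finset.sum_le_sum (s := (Finset.univ : Finset (Fin n)))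
      (f := fun _ => -(b ^ 3)) (fun i _ =>
      acuteTerm_lower (x := x i) (y := y i) (z := z i) (hx i) (hy i) (hz i) ha3p.le hb3p.le hc3p.le
      (by linarith) (by linarith) (by linarith) hb3p.le (Or.inr (by linarith))
      (Or.inr (by linarith)) (by nlinarith [mul_nonneg (sub_nonneg.2 ha3) (sub_nonneg.2 hc3)]))
    simpa using this
  have hna : (n : ℝ) * b ^ 3 ≤ b ^ 2 * (1 / 10) := by
    have e : (n : ℝ) * b ^ 3 = b ^ 2 * (n * b) := by ring
    rw [e]
    gcongr
    nlinarith
  have hh : b ^ 2 * (1 / 2) ≤ (a - b) * (c - b) := by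
    have e1 : b * (9 / 10) ≤ b - a := by linarith
    have e2 : b * (9 / 10) ≤ b - c := by linarith
    have e3 : (b * (9 / 10)) * (b * (9 / 10)) ≤ (b - a) * (b - c) := by gcongr; linarith
    nlinarith [mul_pos hb hb]
  have : 0 < b ^ 2 := by positivity
  linarith

theorem key_both {n : ℕ} (x y z : Fin n → ℝ) (hx : ∀ i, x i = 0 ∨ x i = 1)
    (hy : ∀ i, y i = 0 ∨ y i = 1) (hz : ∀ i, z i = 0 ∨ z i = 1)
    (i₀ : Fin n) (h1 : x i₀ ≠ y i₀) (h2 : z i₀ ≠ y i₀)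
    (a b c t : ℝ) (ha : 0 < a) (hb : 0 < b) (hc : 0 < c) (ht : ((n : ℝ) + 1) * t ≤ 1 / 10)
    (hat : a ≤ t) (hbt : b ≤ t) (hct : c ≤ t) :
    0 < ∑ i, acuteTerm (x i) (y i) (z i) (a ^ 3) (b ^ 3) (c ^ 3) + (a - b) * (c - b) := by
  have hn : (0 : ℝ) ≤ n := Nat.cast_nonneg n
  have htp : 0 < t := by linarith
  have ht1 : t ≤ 1 / 10 := by nlinarith
  have cube : ∀ s : ℝ, 0 < s → s ≤ t → s ^ 3 ≤ t := by
    intro s hs hst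
    have : s ^ 3 ≤ s ^ 1 := pow_le_pow_of_le_one hs.le (by linarith) (by norm_num)
    linarith [pow_one s]
  have prod : ∀ p q r : ℝ, 0 < p → p ≤ t → 0 < q → q ≤ t → 0 < r → r ≤ t →
      -t ≤ (p - q) * (r - q) := by
    intro p q r hp hp' hq hq' hr hr'
    nlinarith [mul_pos hp hr, mul_pos hq hq, mul_le_mul hp' hq' hq.le htp.le,
      mul_le_mul hr' hq' hq.le htp.le]
  have ha3 := cube a ha hat
  have hb3 := cube b hb hbt
  have hc3 := cube c hc hct
  have hb3p : 0 < b ^ 3 := by positivity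
  have ha3p : 0 < a ^ 3 := by positivity
  have hc3p : 0 < c ^ 3 := by positivity
  have hS := sum_lower (fun i => acuteTerm (x i) (y i) (z i) (a ^ 3) (b ^ 3) (c ^ 3)) t
    (1 / 2) i₀ htp.le
    (fun i => acuteTerm_lower (hx i) (hy i) (hz i) ha3p.le hb3p.le hc3p.le
      (by linarith) (by linarith) (by linarith) htp.le (Or.inr (by linarith))
      (Or.inr (by linarith)) (prod _ _ _ ha3p ha3 hb3p hb3 hc3p hc3))
    (acuteTerm_both (hx i₀) (hy i₀) (hz i₀) ha3p.le hb3p.le hc3p.le (by linarith) (by linarith)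
      (by linarith) h1 h2)
  have := prod a b c ha hat hb hbt hc hct
  linarith

theorem key {n : ℕ} (x y z : Fin n → ℝ) (hx : ∀ i, x i = 0 ∨ x i = 1)
    (hy : ∀ i, y i = 0 ∨ y i = 1) (hz : ∀ i, z i = 0 ∨ z i = 1)
    (hxy : x ≠ y) (hzy : z ≠ y) (t : ℝ) (ht0 : 0 < t) (ht : ((n : ℝ) + 1) * t ≤ 1 / 10)
    (k l m : ℕ) (hkl : k ≠ l) (hlm : l ≠ m) (hkm : k ≠ m) :
    0 < ∑ i, acuteTerm (x i) (y i) (z i) ((t ^ 4 ^ k) ^ 3) ((t ^ 4 ^ l) ^ 3) ((t ^ 4 ^ m) ^ 3)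
      + (t ^ 4 ^ k - t ^ 4 ^ l) * (t ^ 4 ^ m - t ^ 4 ^ l) := by
  have hn : (0 : ℝ) ≤ n := Nat.cast_nonneg n
  have ht1 : t ≤ 1 := by nlinarith
  have hp : ∀ k : ℕ, 0 < t ^ 4 ^ k := fun k => by positivity
  have hle : ∀ k : ℕ, t ^ 4 ^ k ≤ t := fun k => by
    have := pow_le_pow_of_le_one ht0.le ht1 (Nat.one_le_pow k 4 (by norm_num))
    simpa using this
  have hlt : ∀ k l : ℕ, k < l → t ^ 4 ^ l ≤ (t ^ 4 ^ k) ^ 4 := fun k l h => by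
    rw [← pow_mul, ← pow_succ]
    exact pow_le_pow_of_le_one ht0.le ht1 (Nat.pow_le_pow_right (by norm_num) h)
  have hsm : ∀ k : ℕ, ((n : ℝ) + 1) * t ^ 4 ^ k ≤ 1 / 10 := fun k => by
    have := mul_le_mul_of_nonneg_left (hle k) (by linarith : (0 : ℝ) ≤ (n : ℝ) + 1)
    linarith
  by_cases hboth : ∃ i, x i ≠ y i ∧ z i ≠ y i
  · obtain ⟨i₀, h1, h2⟩ := hboth
    exact key_both x y z hx hy hz i₀ h1 h2 _ _ _ t (hp _) (hp _) (hp _) ht (hle _) (hle _) (hle _)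
  · have hno : ∀ i, x i = y i ∨ z i = y i := by
      intro i; by_contra h; push Not at h; exact hboth ⟨i, h⟩
    by_cases h1 : l < k ∧ l < m
    · exact key_big_y x y z hx hy hz _ _ _ (hp _) (hp _) (hp _) (hsm _) (hlt _ _ h1.1)
        (hlt _ _ h1.2)
    by_cases h2 : k < l ∧ k < m
    · exact key_big_x x y z hx hy hz (Function.ne_iff.1 hzy) hno _ _ _ (hp _) (hp _) (hp _)
        (hsm _) (hlt _ _ h2.1) (hlt _ _ h2.2)
    have h3 : m < l ∧ m < k := by omega
    have := key_big_x z y x hz hy hx (Function.ne_iff.1 hxy) (fun i => (hno i).symm)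
      _ _ _ (hp m) (hp l) (hp k) (hsm _) (hlt _ _ h3.1) (hlt _ _ h3.2)
    rw [mul_comm] at this
    simpa only [acuteTerm_swap] using (by
      simp_rw [acuteTerm_swap (x _)]
      exact this : 0 < ∑ i, acuteTerm (x i) (y i) (z i) ((t ^ 4 ^ k) ^ 3) ((t ^ 4 ^ l) ^ 3)
        ((t ^ 4 ^ m) ^ 3) + (t ^ 4 ^ k - t ^ 4 ^ l) * (t ^ 4 ^ m - t ^ 4 ^ l))

theorem hypercube_eq_image (n : ℕ) : hypercube (n + 1) =
    (WithLp.toLp 2) '' ((Fintype.piFinset (fun i : Fin (n + 1) =>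
      if (i : ℕ) = n then ({0} : Finset ℝ) else {0, 1}) : Finset (Fin (n + 1) → ℝ)) :
        Set (Fin (n + 1) → ℝ)) := by
  ext v
  simp only [hypercube, Set.mem_ofPred_eq, Set.mem_image, Finset.mem_coe, Fintype.mem_piFinset]
  constructor
  · intro h
    refine ⟨fun i => v i, fun i => ?_, rfl⟩
    have := h i
    simp only [Nat.add_sub_cancel] at this
    split_ifs at this ⊢ <;> simpa using this
  · rintro ⟨w, hw, rfl⟩ i
    have := hw i
    simp only [Nat.add_sub_cancel]
    split_ifs at this ⊢ <;> simpa using this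

theorem hypercube_finite (n : ℕ) : (hypercube (n + 1)).Finite := by
  rw [hypercube_eq_image]
  exact (Finset.finite_toSet _).image _

theorem hypercube_ncard (n : ℕ) : (hypercube (n + 1)).ncard = 2 ^ n := by
  rw [hypercube_eq_image, Set.ncard_image_of_injective _ (WithLp.toLp_injective 2),
    Set.ncard_coe_finset, Fintype.card_piFinset, Fin.prod_univ_castSucc]
  have : ∀ i : Fin n, ((i : ℕ) = n) = False := fun i => by
    have := i.2
    simp; omega
  simp [this]

theorem hypercube_last {n : ℕ} {v : EuclideanSpace ℝ (Fin (n + 1))} (hv : v ∈ hypercube (n + 1)) :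
    v (Fin.last n) = 0 := by
  have := hv (Fin.last n)
  simpa using this

theorem hypercube_castSucc {n : ℕ} {v : EuclideanSpace ℝ (Fin (n + 1))}
    (hv : v ∈ hypercube (n + 1)) (i : Fin n) : v i.castSucc = 0 ∨ v i.castSucc = 1 := by
  have := hv i.castSucc
  have hi : ¬ (i : ℕ) = n := by have := i.2; omega
  simpa [hi] using this

/-- The perturbation: pull a vertex with height `e` inward by `e ^ 3`, and lift it by `e`. -/
noncomputable def perturb (n : ℕ) (e : EuclideanSpace ℝ (Fin (n + 1)) → ℝ)
    (v : EuclideanSpace ℝ (Fin (n + 1))) : EuclideanSpace ℝ (Fin (n + 1)) :=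
  WithLp.toLp 2 (Fin.snoc (α := fun _ => ℝ)
    (fun i : Fin n => v i.castSucc + e v ^ 3 * (1 - 2 * v i.castSucc)) (e v))

theorem perturb_last (n : ℕ) (e : EuclideanSpace ℝ (Fin (n + 1)) → ℝ)
    (v : EuclideanSpace ℝ (Fin (n + 1))) : perturb n e v (Fin.last n) = e v := by
  simp [perturb]

theorem perturb_castSucc (n : ℕ) (e : EuclideanSpace ℝ (Fin (n + 1)) → ℝ)
    (v : EuclideanSpace ℝ (Fin (n + 1))) (i : Fin n) :
    perturb n e v i.castSucc = v i.castSucc + e v ^ 3 * (1 - 2 * v i.castSucc) := by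
  simp [perturb]

theorem hypercube_ext {n : ℕ} {v w : EuclideanSpace ℝ (Fin (n + 1))}
    (hv : v ∈ hypercube (n + 1)) (hw : w ∈ hypercube (n + 1))
    (h : (fun i : Fin n => v i.castSucc) = fun i => w i.castSucc) : v = w := by
  ext i
  refine Fin.lastCases ?_ (fun i => ?_) i
  · rw [hypercube_last hv, hypercube_last hw]
  · exact congrFun h i

/-- For every `δ > 0` each vertex `x` of the hypercube `X = {0,1}^(d-1) × {0} ⊂ ℝ^d`
can be moved by distance at most `δ` to a point `x'` so that the resulting `2^(d-1)`
points form an acute set (in particular the assignment is injective on `X`). -/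
theorem exists_perturbation_of_hypercube_acute (d : ℕ) (hd : 2 ≤ d) (δ : ℝ) (hδ : 0 < δ) :
    ∃ f : EuclideanSpace ℝ (Fin d) → EuclideanSpace ℝ (Fin d),
      (∀ x ∈ hypercube d, dist x (f x) ≤ δ) ∧
      Set.InjOn f (hypercube d) ∧
      (f '' hypercube d).ncard = 2 ^ (d - 1) ∧
      ∀ p ∈ f '' hypercube d, ∀ q ∈ f '' hypercube d, ∀ r ∈ f '' hypercube d,
        p ≠ q → q ≠ r → p ≠ r →
        EuclideanGeometry.angle p q r < Real.pi / 2 := by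
  obtain ⟨n, rfl⟩ : ∃ n, d = n + 1 := ⟨d - 1, by omega⟩
  obtain ⟨ρ, hρ⟩ := Set.countable_iff_exists_injOn.1 (hypercube_finite n).countable
  have hn : (0 : ℝ) ≤ n := Nat.cast_nonneg n
  obtain ⟨t, ht0, ht, htδ⟩ : ∃ t : ℝ, 0 < t ∧ ((n : ℝ) + 1) * t ≤ 1 / 10 ∧ t ≤ δ / 2 := by
    refine ⟨min (1 / 10 / ((n : ℝ) + 1)) (δ / 2), by positivity, ?_, min_le_right _ _⟩
    rw [mul_comm, ← le_div_iff₀ (by positivity)]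
    exact min_le_left _ _
  have ht1 : t ≤ 1 / 10 := by nlinarith
  have hle : ∀ k : ℕ, t ^ 4 ^ k ≤ t := fun k => by
    have := pow_le_pow_of_le_one ht0.le (by linarith) (Nat.one_le_pow k 4 (by norm_num))
    simpa using this
  have hinj : Set.InjOn (perturb n fun v => t ^ 4 ^ ρ v) (hypercube (n + 1)) := by
    intro v hv w hw h
    have h1 := congrArg (fun u : EuclideanSpace ℝ (Fin (n + 1)) => u (Fin.last n)) h
    simp only [perturb_last] at h1
    have h2 := (pow_right_strictAnti₀ ht0 (by linarith : t < 1)).injective h1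
    exact hρ hv hw (Nat.pow_right_injective (le_refl 2 |>.trans (by norm_num)) h2)
  refine ⟨perturb n fun v => t ^ 4 ^ ρ v, ?_, hinj, ?_, ?_⟩
  · intro x hx
    rw [EuclideanSpace.dist_eq, Fin.sum_univ_castSucc]
    refine Real.sqrt_le_iff.2 ⟨hδ.le, ?_⟩
    simp only [perturb_last, perturb_castSucc, hypercube_last hx, Real.dist_eq, sq_abs]
    set e := t ^ 4 ^ ρ x with he
    have hep : 0 < e := by positivity
    have het : e ≤ t := hle _
    have h3 : e ^ 3 ≤ t := by
      have : e ^ 3 ≤ e ^ 1 := pow_le_pow_of_le_one hep.le (by linarith) (by norm_num)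
      linarith [pow_one e]
    have hterm : ∀ i : Fin n, (x i.castSucc - (x i.castSucc + e ^ 3 * (1 - 2 * x i.castSucc))) ^ 2
        ≤ t ^ 2 * t := by
      intro i
      have : (x i.castSucc - (x i.castSucc + e ^ 3 * (1 - 2 * x i.castSucc))) ^ 2
          = e ^ 3 * e ^ 3 := by
        rcases hypercube_castSucc hx i with h | h <;> rw [h] <;> ring
      rw [this]
      have h4 : e ^ 3 ≤ t ^ 2 := by
        have : e ^ 3 ≤ e ^ 2 := pow_le_pow_of_le_one hep.le (by linarith) (by norm_num)
        have : e ^ 2 ≤ t ^ 2 := by gcongr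
        linarith
      gcongr
    have hs := Finset.sum_le_sum (s := (Finset.univ : Finset (Fin n))) fun i _ => hterm i
    simp only [Finset.sum_const, Finset.card_univ, Fintype.card_fin, nsmul_eq_mul] at hs
    have h5 : (n : ℝ) * (t ^ 2 * t) ≤ t ^ 2 * 1 := by
      have : (n : ℝ) * (t ^ 2 * t) = t ^ 2 * (n * t) := by ring
      rw [this]; gcongr; nlinarith
    have h6 : (0 - e) ^ 2 ≤ t ^ 2 := by
      rw [zero_sub, neg_sq]; gcongr
    nlinarith
  · rw [hinj.ncard_image, hypercube_ncard, Nat.add_sub_cancel]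
  · rintro _ ⟨x, hx, rfl⟩ _ ⟨y, hy, rfl⟩ _ ⟨z, hz, rfl⟩ hxy hyz hxz
    have hxy' : x ≠ y := fun h => hxy (by rw [h])
    have hyz' : y ≠ z := fun h => hyz (by rw [h])
    have hxz' : x ≠ z := fun h => hxz (by rw [h])
    have hpos := key (fun i => x i.castSucc) (fun i => y i.castSucc) (fun i => z i.castSucc)
      (hypercube_castSucc hx) (hypercube_castSucc hy) (hypercube_castSucc hz)
      (fun h => hxy' (hypercube_ext hx hy h)) (fun h => hyz' (hypercube_ext hz hy h).symm)
      t ht0 ht (ρ x) (ρ y) (ρ z) (fun h => hxy' (hρ hx hy h)) (fun h => hyz' (hρ hy hz h))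
      (fun h => hxz' (hρ hx hz h))
    unfold EuclideanGeometry.angle InnerProductGeometry.angle
    rw [Real.arccos_lt_pi_div_two]
    refine div_pos ?_ (mul_pos (norm_pos_iff.2 (vsub_ne_zero.2 hxy))
      (norm_pos_iff.2 (vsub_ne_zero.2 hyz.symm)))
    rw [PiLp.inner_apply, Fin.sum_univ_castSucc]
    simp only [vsub_eq_sub, PiLp.sub_apply, perturb_last, perturb_castSucc, RCLike.inner_apply,
      conj_trivial]
    refine lt_of_lt_of_eq hpos ?_
    unfold acuteTerm
    congr 1
    · exact Finset.sum_congr rfl fun i _ => mul_comm _ _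
    · exact mul_comm _ _
end
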